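/- Let n ≥ 1, α > 0, let u : ℝⁿ → ℝ be a Schwartz function, and set v := u - α²Δu. Then: (i) ‖u‖_{L^p(ℝⁿ)} ≤ ‖v‖_{L^p(ℝⁿ)} for every p ∈ [1,∞]; (ii) if 1 ≤ r ≤ p ≤ ∞ and γ := (n/2)(1/r - 1/p) < 1, there exists a constant C = C(n,p,r,α) > 0 such that ‖u‖_{L^p} ≤ C ‖v‖_{L^r}; (iii) if moreover γ < 1/2, there exists a constant C' = C'(n,p,r,α) > 0 such that ‖∇u‖_{L^p} ≤ C' ‖v‖_{L^r}. -/

import Mathlib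

open MeasureTheory Real ENNReal

noncomputable section

/-- Partial derivative in the `i`-th coordinate direction on `ℝⁿ`. -/
def pdN {n : ℕ} (i : Fin n) (f : EuclideanSpace ℝ (Fin n) → ℝ)
    (x : EuclideanSpace ℝ (Fin n)) : ℝ :=
  fderiv ℝ f x (EuclideanSpace.single i 1)

/-- The Laplacian on `ℝⁿ`. -/
def lapN {n : ℕ} (f : EuclideanSpace ℝ (Fin n) → ℝ) (x : EuclideanSpace ℝ (Fin n)) : ℝ :=
  ∑ i : Fin n, pdN i (pdN i f) x

open scoped FourierTransform SchwartzMap Laplacian LineDeriv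

abbrev hzE (n : ℕ) := EuclideanSpace ℝ (Fin n)

/-- heat kernel -/
def hzK (n : ℕ) (α t : ℝ) (z : hzE n) : ℝ :=
  (4 * π * α ^ 2 * t) ^ (-(n : ℝ) / 2) * rexp (-‖z‖ ^ 2 / (4 * α ^ 2 * t))

lemma hz_fourier {n : ℕ} (α : ℝ) (f : 𝓢(hzE n, ℂ)) (ξ : hzE n) :
    𝓕 (f - (α ^ 2) • Δ f) ξ = ((1 + 4 * π ^ 2 * α ^ 2 * ‖ξ‖ ^ 2 : ℝ) : ℂ) * 𝓕 f ξ := by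
  have h : 𝓕 (Δ f) = -(2 * π) ^ 2 • SchwartzMap.smulLeftCLM ℂ (fun x : hzE n => ‖x‖ ^ 2) (𝓕 f) := by
    rw [SchwartzMap.laplacian_eq_fourierMultiplierCLM, SchwartzMap.fourierMultiplierCLM_apply,
      ← FourierTransform.fourierInv_smul, FourierTransform.fourier_fourierInv_eq]
  have h2 : 𝓕 (f - (α ^ 2) • Δ f) = 𝓕 f - (α ^ 2) • 𝓕 (Δ f) := by
    have := (FourierTransform.fourierCLM ℝ 𝓢(hzE n, ℂ)).map_sub f ((α ^ 2) • Δ f)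
    rw [map_smul] at this
    simpa using this
  rw [h2, h]
  have : (fun x : hzE n => ‖x‖ ^ 2).HasTemperateGrowth := by fun_prop
  simp [SchwartzMap.smulLeftCLM_apply_apply this]
  ring

lemma hz_gauss {n : ℕ} {α t : ℝ} (hα : 0 < α) (ht : 0 < t) (g : 𝓢(hzE n, ℂ)) (x : hzE n) :
    ∫ ξ, 𝓕 g ξ * Complex.exp (-((4 * π ^ 2 * α ^ 2 * t : ℝ) : ℂ) * ‖ξ‖ ^ 2
      + 2 * π * Complex.I * (inner ℝ x ξ : ℝ))
      = ∫ y, g y * (hzK n α t (x - y) : ℂ) := by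
  have hb : 0 < 4 * π ^ 2 * α ^ 2 * t := by positivity
  have hi : Integrable (fun ξ : hzE n => Complex.exp (-((4 * π ^ 2 * α ^ 2 * t : ℝ) : ℂ) * ‖ξ‖ ^ 2
      + 2 * π * Complex.I * (inner ℝ x ξ : ℝ))) :=
    GaussianFourier.integrable_cexp_neg_mul_sq_norm_add (by rw [Complex.ofReal_re]; exact hb) _ _
  have := VectorFourier.integral_fourierIntegral_smul_eq_flip (L := innerₗ (hzE n)) (μ := volume)
    (ν := volume)
    continuous_fourierChar continuous_inner g.integrable hi
  simp only [smul_eq_mul] at this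
  refine Eq.trans ?_ (this.trans ?_)
  · rfl
  · congr 1
    ext y
    congr 1
    rw [flip_innerₗ]
    have := fourier_gaussian_innerProductSpace' (V := hzE n)
      (b := ((4 * π ^ 2 * α ^ 2 * t : ℝ) : ℂ)) (by rw [Complex.ofReal_re]; exact hb) x y
    refine Eq.trans ?_ (this.trans ?_)
    · rfl
    · unfold hzK
      have e1 : (π : ℂ) / ((4 * π ^ 2 * α ^ 2 * t : ℝ) : ℂ) = (((4 * π * α ^ 2 * t)⁻¹ : ℝ) : ℂ) := by
        rw [← Complex.ofReal_div]; congr 1; field_simp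
      rw [e1, Complex.ofReal_mul (_ ^ _), Complex.ofReal_exp, neg_div,
        Real.rpow_neg (by positivity), ← Real.inv_rpow (by positivity),
        Complex.ofReal_cpow (by positivity)]
      simp only [finrank_euclideanSpace, Fintype.card_fin]
      congr 1
      · push_cast; rfl
      · congr 1
        push_cast
        have : (π:ℂ) ≠ 0 := by exact_mod_cast pi_ne_zero
        have : (α:ℂ) ≠ 0 := by exact_mod_cast hα.ne'
        have : (t:ℂ) ≠ 0 := by exact_mod_cast ht.ne'
        field_simp

lemma hz_exp_int {A : ℝ} (hA : 0 < A) : ∫ t in Set.Ioi (0:ℝ), rexp (-t * A) = A⁻¹ := by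
  have := integral_exp_mul_Ioi (a := -A) (by linarith) 0
  simp at this
  simpa [mul_comm] using this

lemma hz_repC {n : ℕ} {α : ℝ} (hα : 0 < α) (f : 𝓢(hzE n, ℂ)) (x : hzE n) :
    f x = ∫ t in Set.Ioi (0:ℝ), (rexp (-t) : ℂ) *
      ∫ y, (f - (α ^ 2) • Δ f) y * (hzK n α t (x - y) : ℂ) := by
  set g := f - (α ^ 2) • Δ f with hg
  have hA : ∀ ξ : hzE n, 0 < 1 + 4 * π ^ 2 * α ^ 2 * ‖ξ‖ ^ 2 := fun ξ => by positivity
  have h1 : f x = ∫ ξ, Complex.exp ((↑(2 * π * inner ℝ ξ x) * Complex.I)) • 𝓕 f ξ := by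
    rw [← Real.fourierInv_eq', SchwartzMap.fourier_coe]
    rw [f.continuous.fourierInv_fourier_eq f.integrable]
    rw [← SchwartzMap.fourier_coe]
    exact (𝓕 f).integrable
  let F : hzE n → ℝ → ℂ := fun ξ t => (rexp (-t * (1 + 4 * π ^ 2 * α ^ 2 * ‖ξ‖ ^ 2)) : ℂ) *
    (Complex.exp ((↑(2 * π * inner ℝ ξ x) * Complex.I)) * 𝓕 g ξ)
  have h2 : f x = ∫ ξ, ∫ t in Set.Ioi (0:ℝ), F ξ t := by
    rw [h1]
    congr 1
    ext ξ
    simp only [F]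
    rw [integral_mul_const, integral_complex_ofReal, hz_exp_int (hA ξ), hz_fourier]
    have : ((1 + 4 * π ^ 2 * α ^ 2 * ‖ξ‖ ^ 2 : ℝ) : ℂ) ≠ 0 := by exact_mod_cast (hA ξ).ne'
    rw [smul_eq_mul, Complex.ofReal_inv]
    generalize ((1 + 4 * π ^ 2 * α ^ 2 * ‖ξ‖ ^ 2 : ℝ) : ℂ) = c at *
    field_simp
  have hint : Integrable (Function.uncurry F) (volume.prod (volume.restrict (Set.Ioi (0:ℝ)))) := by
    have hd : Integrable (fun z : hzE n × ℝ => ‖𝓕 g z.1‖ * rexp (-z.2))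
        (volume.prod (volume.restrict (Set.Ioi (0:ℝ)))) := by
      apply Integrable.mul_prod (f := fun ξ => ‖𝓕 g ξ‖) (g := fun t => rexp (-t))
      · exact (𝓕 g).integrable.norm
      · exact integrableOn_exp_neg_Ioi 0
    refine hd.mono' ?_ ?_
    · apply Continuous.aestronglyMeasurable
      have := (𝓕 g).continuous
      simp only [F, Function.uncurry_def]
      fun_prop
    · have : ∀ᵐ z : hzE n × ℝ ∂(volume.prod (volume.restrict (Set.Ioi (0:ℝ)))), z.2 ∈ Set.Ioi (0:ℝ) := by
        have := Measure.quasiMeasurePreserving_snd (μ := (volume : Measure (hzE n)))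
          (ν := volume.restrict (Set.Ioi (0:ℝ)))
        exact this.ae (ae_restrict_mem measurableSet_Ioi)
      filter_upwards [this] with z hz
      simp only [F, Function.uncurry_def, norm_mul, Complex.norm_exp_ofReal_mul_I, one_mul]
      rw [mul_comm, Complex.norm_real, Real.norm_eq_abs, abs_of_pos (Real.exp_pos _)]
      gcongr
      have : (0:ℝ) < z.2 := hz
      have : 0 ≤ z.2 * (4 * π ^ 2 * α ^ 2 * ‖z.1‖ ^ 2) := by positivity
      nlinarith
  rw [h2, integral_integral_swap hint]
  refine setIntegral_congr_fun measurableSet_Ioi fun t ht => ?_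
  rw [← hz_gauss hα ht, ← integral_const_mul]
  congr 1
  ext ξ
  simp only [F]
  rw [mul_comm (𝓕 g ξ), ← mul_assoc, ← mul_assoc]
  congr 1
  rw [Complex.ofReal_exp, Complex.ofReal_exp, ← Complex.exp_add, ← Complex.exp_add]
  congr 1
  rw [real_inner_comm]
  push_cast
  ring

lemma hz_lap {n : ℕ} (u : 𝓢(hzE n, ℝ)) (x : hzE n) : lapN (⇑u) x = Δ u x := by
  rw [SchwartzMap.laplacian_eq_sum (EuclideanSpace.basisFun (Fin n) ℝ), sum_apply]
  simp only [lapN, pdN, EuclideanSpace.basisFun_apply]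
  rfl

lemma hz_compl_deriv {n : ℕ} (u : 𝓢(hzE n, ℝ)) (m : hzE n) :
    ∂_{m} (u.postcompCLM Complex.ofRealCLM) = (∂_{m} u).postcompCLM Complex.ofRealCLM := by
  ext x
  rw [SchwartzMap.lineDerivOp_apply_eq_fderiv, SchwartzMap.postcompCLM_apply,
    SchwartzMap.lineDerivOp_apply_eq_fderiv]
  have h := (Complex.ofRealCLM.hasFDerivAt (x := u x)).comp x (u.hasFDerivAt x)
  have h2 : fderiv ℝ (⇑(u.postcompCLM Complex.ofRealCLM)) x = _ := h.fderiv
  rw [h2]; rfl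

lemma hz_compl_lap {n : ℕ} (u : 𝓢(hzE n, ℝ)) :
    Δ (u.postcompCLM Complex.ofRealCLM) = (Δ u).postcompCLM Complex.ofRealCLM := by
  rw [SchwartzMap.laplacian_eq_sum (EuclideanSpace.basisFun (Fin n) ℝ),
    SchwartzMap.laplacian_eq_sum (EuclideanSpace.basisFun (Fin n) ℝ), map_sum]
  simp only [hz_compl_deriv]

lemma hz_rep {n : ℕ} {α : ℝ} (hα : 0 < α) (u : 𝓢(hzE n, ℝ)) (x : hzE n) :
    u x = ∫ t in Set.Ioi (0:ℝ), rexp (-t) *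
      ∫ y, hzK n α t (x - y) * (u - (α ^ 2) • Δ u) y := by
  have h := hz_repC hα (u.postcompCLM Complex.ofRealCLM) x
  rw [hz_compl_lap, ← map_smul, ← map_sub] at h
  simp only [SchwartzMap.postcompCLM_apply, Complex.ofRealCLM_apply, ← Complex.ofReal_mul,
    integral_complex_ofReal] at h
  have h' := Complex.ofReal_injective h
  rw [h']
  simp only [mul_comm]

lemma hz_holder {X : Type*} [MeasurableSpace X] {μ : Measure X} {q r : ℝ≥0∞}
    (h : q⁻¹ + r⁻¹ = 1) {A B : X → ℝ≥0∞} (hA : Measurable A) (hB : Measurable B) :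
    ∫⁻ y, A y * B y ∂μ ≤ eLpNorm A q μ * eLpNorm B r μ := by
  have hq0 : q ≠ 0 := by rintro rfl; simp at h
  have hr0 : r ≠ 0 := by rintro rfl; simp at h
  by_cases hr : r = ∞
  · subst hr
    have hq : q = 1 := by simpa using h
    subst hq
    rw [eLpNorm_one_eq_lintegral_enorm, eLpNorm_exponent_top]
    have := ae_le_eLpNormEssSup (f := B) (μ := μ)
    calc ∫⁻ y, A y * B y ∂μ ≤ ∫⁻ y, A y * eLpNormEssSup B μ ∂μ := by
          apply lintegral_mono_ae
          filter_upwards [this] with y hy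
          gcongr; simpa using hy
      _ = _ := by rw [lintegral_mul_const _ hA]; simp
  by_cases hq : q = ∞
  · subst hq
    have hq : r = 1 := by simpa using h
    subst hq
    rw [eLpNorm_one_eq_lintegral_enorm, eLpNorm_exponent_top]
    have := ae_le_eLpNormEssSup (f := A) (μ := μ)
    calc ∫⁻ y, A y * B y ∂μ ≤ ∫⁻ y, eLpNormEssSup A μ * B y ∂μ := by
          apply lintegral_mono_ae
          filter_upwards [this] with y hy
          gcongr; simpa using hy
      _ = _ := by rw [lintegral_const_mul _ hB]; simp
  have hc : q.toReal.HolderConjugate r.toReal := by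
    have := congrArg ENNReal.toReal h
    rw [ENNReal.toReal_add (by simpa) (by simpa)] at this
    simp only [ENNReal.toReal_inv, ENNReal.toReal_one] at this
    refine ⟨by simpa using this, ENNReal.toReal_pos hq0 hq, ENNReal.toReal_pos hr0 hr⟩
  rw [eLpNorm_eq_lintegral_rpow_enorm_toReal hq0 hq, eLpNorm_eq_lintegral_rpow_enorm_toReal hr0 hr]
  simpa using ENNReal.lintegral_mul_le_Lp_mul_Lq μ hc hA.aemeasurable hB.aemeasurable

lemma hz_young {n : ℕ} {p q r : ℝ≥0∞} (hr : 1 ≤ r) (hrp : r ≤ p)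
    (h : q⁻¹ + r⁻¹ = 1 + p⁻¹) {G f : hzE n → ℝ≥0∞} (hG : Measurable G) (hf : Measurable f) :
    eLpNorm (fun x => ∫⁻ y, G (x - y) * f y) p volume
      ≤ eLpNorm G q volume * eLpNorm f r volume := by
  by_cases hp : p = ∞
  · subst hp
    rw [eLpNorm_exponent_top]
    refine eLpNormEssSup_le_of_ae_enorm_bound (Filter.Eventually.of_forall fun x => ?_)
    have h1 := hz_holder (μ := volume) (by simpa using h)
      (show Measurable (fun y => G (x - y)) by fun_prop) hf
    have h2 : eLpNorm (fun y => G (x - y)) q volume = eLpNorm G q volume :=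
      eLpNorm_comp_measurePreserving (g := G) hG.aestronglyMeasurable
        (Measure.measurePreserving_sub_left volume x)
    rw [h2] at h1
    simpa using h1
  have hr' : r ≠ ∞ := fun h' => hp (top_le_iff.mp (h' ▸ hrp))
  have hr0 : r ≠ 0 := (one_pos.trans_le hr).ne'
  have hp0 : p ≠ 0 := ((one_pos.trans_le hr).trans_le hrp).ne'
  have hq0 : q ≠ 0 := by
    rintro rfl
    have h' : 1 + p⁻¹ ≠ ∞ := by simp [hp0]
    simp only [ENNReal.inv_zero, top_add] at h
    exact h' h.symm
  have hri : r⁻¹ ≤ 1 := ENNReal.inv_le_one.mpr hr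
  have hq : q ≠ ∞ := by
    rintro rfl
    simp only [ENNReal.inv_top, zero_add] at h
    have : (1:ℝ≥0∞) + p⁻¹ ≤ 1 + 0 := by simpa [h] using hri
    have := (ENNReal.add_le_add_iff_left (by simp)).mp this
    simp [hp] at this
  have hR := congrArg ENNReal.toReal h
  rw [ENNReal.toReal_add (by simpa) (by simpa), ENNReal.toReal_add (by simp) (by simpa)] at hR
  simp only [ENNReal.toReal_inv, ENNReal.toReal_one] at hR
  have hR1 : r.toReal⁻¹ ≤ 1 := by
    have := ENNReal.toReal_mono (by simp) hri
    simpa using this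
  have hRP : p.toReal⁻¹ ≤ r.toReal⁻¹ := by
    have := ENNReal.toReal_mono (by simpa) (ENNReal.inv_le_inv.mpr hrp)
    simpa using this
  rw [eLpNorm_eq_lintegral_rpow_enorm_toReal hq0 hq, eLpNorm_eq_lintegral_rpow_enorm_toReal hr0 hr',
    eLpNorm_eq_lintegral_rpow_enorm_toReal hp0 hp]
  have hP := ENNReal.toReal_pos hp0 hp
  have hQ := ENNReal.toReal_pos hq0 hq
  have hRr := ENNReal.toReal_pos hr0 hr'
  generalize p.toReal = P at *
  generalize q.toReal = Q at *
  generalize r.toReal = R at *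
  simp only [enorm_eq_self, one_div]
  set A := ∫⁻ x, G x ^ Q with hA
  set B := ∫⁻ x, f x ^ R with hB
  have hpt : ∀ x, ∫⁻ y, G (x - y) * f y ≤
      (∫⁻ y, G (x - y) ^ Q * f y ^ R) ^ P⁻¹ * (A ^ (1 - R⁻¹) * B ^ (R⁻¹ - P⁻¹)) := by
    intro x
    have := ENNReal.lintegral_prod_norm_pow_le (μ := (volume : Measure (hzE n))) Finset.univ
      (f := ![fun y => G (x - y) ^ Q * f y ^ R, fun y => G (x - y) ^ Q, fun y => f y ^ R])
      (p := ![P⁻¹, 1 - R⁻¹, R⁻¹ - P⁻¹])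
      (by intro i _; fin_cases i <;> simp <;> fun_prop)
      (by simp [Fin.sum_univ_succ])
      (by intro i _; fin_cases i <;> simp <;> first | positivity | linarith)
    simp only [Fin.prod_univ_succ, Finset.univ_eq_empty, Finset.prod_empty, mul_one,
      Matrix.cons_val_zero, Matrix.cons_val_succ] at this
    have e : ∫⁻ y, G (x - y) ^ Q = A := lintegral_sub_left_eq_self (fun y => G y ^ Q) x
    rw [e] at this
    refine le_trans (le_of_eq ?_) this
    congr 1
    ext y
    rw [ENNReal.mul_rpow_of_nonneg _ _ (by positivity)]
    simp only [← ENNReal.rpow_mul]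
    have : G (x - y) ^ (Q * P⁻¹) * f y ^ (R * P⁻¹) *
        (G (x - y) ^ (Q * (1 - R⁻¹)) * f y ^ (R * (R⁻¹ - P⁻¹)))
      = (G (x - y) ^ (Q * P⁻¹) * G (x - y) ^ (Q * (1 - R⁻¹))) *
        (f y ^ (R * P⁻¹) * f y ^ (R * (R⁻¹ - P⁻¹))) := by ring
    rw [this, ← ENNReal.rpow_add_of_nonneg _ _ (by positivity) (mul_nonneg hQ.le (by linarith)),
      ← ENNReal.rpow_add_of_nonneg _ _ (by positivity) (mul_nonneg hRr.le (by linarith))]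
    have e1 : Q * P⁻¹ + Q * (1 - R⁻¹) = 1 := by
      have : P⁻¹ + (1 - R⁻¹) = Q⁻¹ := by linarith
      rw [← mul_add, this, mul_inv_cancel₀ hQ.ne']
    have e2 : R * P⁻¹ + R * (R⁻¹ - P⁻¹) = 1 := by
      rw [← mul_add]; simp [hRr.ne']
    rw [e1, e2]; simp
  have hI : ∫⁻ x, (∫⁻ y, G (x - y) * f y) ^ P ≤ A * B * (A ^ (1 - R⁻¹) * B ^ (R⁻¹ - P⁻¹)) ^ P := by
    calc _ ≤ ∫⁻ x, (∫⁻ y, G (x - y) ^ Q * f y ^ R) * (A ^ (1 - R⁻¹) * B ^ (R⁻¹ - P⁻¹)) ^ P := by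
          apply lintegral_mono
          intro x
          refine (ENNReal.rpow_le_rpow (hpt x) hP.le).trans (le_of_eq ?_)
          rw [ENNReal.mul_rpow_of_nonneg _ _ hP.le, ← ENNReal.rpow_mul, inv_mul_cancel₀ hP.ne',
            ENNReal.rpow_one]
      _ = _ := by
          rw [lintegral_mul_const _ (by fun_prop)]
          congr 1
          rw [lintegral_lintegral_swap (by fun_prop)]
          have : ∀ y, ∫⁻ x, G (x - y) ^ Q * f y ^ R = A * f y ^ R := by
            intro y
            rw [lintegral_mul_const _ (by fun_prop)]
            congr 1
            exact lintegral_sub_right_eq_self (fun y => G y ^ Q) y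
          simp only [this]
          rw [lintegral_const_mul _ (by fun_prop)]
  refine (ENNReal.rpow_le_rpow hI (by positivity)).trans (le_of_eq ?_)
  have hPi : 0 ≤ P⁻¹ := by positivity
  rw [ENNReal.mul_rpow_of_nonneg _ _ hPi, ENNReal.mul_rpow_of_nonneg _ _ hPi, ← ENNReal.rpow_mul,
    mul_inv_cancel₀ hP.ne', ENNReal.rpow_one]
  have : A ^ P⁻¹ * B ^ P⁻¹ * (A ^ (1 - R⁻¹) * B ^ (R⁻¹ - P⁻¹))
    = (A ^ P⁻¹ * A ^ (1 - R⁻¹)) * (B ^ P⁻¹ * B ^ (R⁻¹ - P⁻¹)) := by ring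
  rw [this, ← ENNReal.rpow_add_of_nonneg _ _ hPi (by linarith),
    ← ENNReal.rpow_add_of_nonneg _ _ hPi (by linarith)]
  congr 2
  · linarith
  · ring

/-- integrand of the kernel -/
def hzk (n : ℕ) (A c a t : ℝ) (z : hzE n) : ℝ :=
  A * (rexp (-t) * t ^ (-a)) * (t ^ (-(n : ℝ) / 2) * rexp (-(c / t) * ‖z‖ ^ 2))

def hzG (n : ℕ) (A c a : ℝ) (z : hzE n) : ℝ≥0∞ :=
  ∫⁻ t in Set.Ioi (0:ℝ), ENNReal.ofReal (hzk n A c a t z)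

lemma hzk_meas (n : ℕ) (A c a : ℝ) :
    Measurable (fun s : hzE n × ℝ => ENNReal.ofReal (hzk n A c a s.2 s.1)) := by
  unfold hzk
  fun_prop

lemma hzG_meas (n : ℕ) (A c a : ℝ) : Measurable (hzG n A c a) := by
  unfold hzG
  exact (hzk_meas n A c a).lintegral_prod_right'

lemma hz_gauss_lint (n : ℕ) {b : ℝ} (hb : 0 < b) :
    ∫⁻ z : hzE n, ENNReal.ofReal (rexp (-b * ‖z‖ ^ 2)) = ENNReal.ofReal ((π / b) ^ ((n : ℝ) / 2)) := by
  have h := GaussianFourier.integral_rexp_neg_mul_sq_norm (V := hzE n) hb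
  have hi : Integrable (fun z : hzE n => rexp (-b * ‖z‖ ^ 2)) := by
    by_contra hc
    rw [integral_undef hc] at h
    have : 0 < (π / b) ^ ((Module.finrank ℝ (hzE n) : ℝ) / 2) := by positivity
    linarith
  rw [← ofReal_integral_eq_lintegral_ofReal hi (Filter.Eventually.of_forall fun _ => by positivity), h]
  simp

lemma hz_W {s : ℝ} (hs : s < 1) :
    ∫⁻ t in Set.Ioi (0:ℝ), ENNReal.ofReal (rexp (-t) * t ^ (-s)) < ∞ := by
  have := Real.GammaIntegral_convergent (s := 1 - s) (by linarith)
  have h2 : IntegrableOn (fun t : ℝ => rexp (-t) * t ^ (-s)) (Set.Ioi 0) := by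
    simpa using this
  exact h2.lintegral_lt_top

lemma hzG_one {n : ℕ} {A c : ℝ} (hA : 0 < A) (hc : 0 < c) (h : A * (π / c) ^ ((n : ℝ) / 2) = 1) :
    eLpNorm (hzG n A c 0) 1 volume = 1 := by
  rw [eLpNorm_one_eq_lintegral_enorm]
  simp only [enorm_eq_self]
  unfold hzG
  rw [lintegral_lintegral_swap (hzk_meas n A c 0).aemeasurable]
  have : ∀ t ∈ Set.Ioi (0:ℝ), ∫⁻ z, ENNReal.ofReal (hzk n A c 0 t z) = ENNReal.ofReal (rexp (-t)) := by
    intro t ht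
    have ht : 0 < t := ht
    have e : ∀ z, ENNReal.ofReal (hzk n A c 0 t z) = ENNReal.ofReal (A * rexp (-t) * t ^ (-(n : ℝ) / 2))
        * ENNReal.ofReal (rexp (-(c / t) * ‖z‖ ^ 2)) := by
      intro z
      rw [← ENNReal.ofReal_mul (by positivity)]
      congr 1
      simp only [hzk, neg_zero, Real.rpow_zero]
      ring
    simp only [e]
    rw [lintegral_const_mul _ (by fun_prop), hz_gauss_lint n (by positivity),
      ← ENNReal.ofReal_mul (by positivity)]
    congr 1
    have e2 : π / (c / t) = (π / c) * t := by field_simp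
    rw [e2, Real.mul_rpow (by positivity) ht.le]
    have e3 : t ^ (-(n : ℝ) / 2) * t ^ ((n : ℝ) / 2) = 1 := by
      rw [← Real.rpow_add ht]; ring_nf; simp
    linear_combination (rexp (-t) * t ^ (-(n : ℝ) / 2) * t ^ ((n : ℝ) / 2)) * h + rexp (-t) * e3
  rw [setLIntegral_congr_fun measurableSet_Ioi this]
  rw [← ofReal_integral_eq_lintegral_ofReal (integrableOn_exp_neg_Ioi 0)
    (Filter.Eventually.of_forall fun _ => by positivity), integral_exp_neg_Ioi]
  simp

lemma hzG_fin {n : ℕ} {A c a : ℝ} (hA : 0 < A) (hc : 0 < c) {q : ℝ≥0∞} (hq : 1 ≤ q)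
    (h : a + (n : ℝ) / 2 * (1 - (q⁻¹).toReal) < 1) :
    eLpNorm (hzG n A c a) q volume < ∞ := by
  set γ := (n : ℝ) / 2 * (1 - (q⁻¹).toReal) with hγ
  have hW := hz_W h
  set W : ℝ → ℝ≥0∞ := fun t => ENNReal.ofReal (rexp (-t) * t ^ (-(a + γ))) with hWd
  have hWm : Measurable W := by rw [hWd]; fun_prop
  let H : hzE n → ℝ → ℝ≥0∞ := fun z t =>
    ENNReal.ofReal (A * t ^ (γ - (n : ℝ) / 2) * rexp (-(c / t) * ‖z‖ ^ 2))
  have hHm : Measurable (Function.uncurry H) := by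
    simp only [H, Function.uncurry_def]; fun_prop
  have hGe : ∀ z, hzG n A c a z = ∫⁻ t in Set.Ioi (0:ℝ), W t * H z t := by
    intro z
    refine setLIntegral_congr_fun measurableSet_Ioi fun t ht => ?_
    have ht : 0 < t := ht
    simp only [W, H, hzk]
    rw [← ENNReal.ofReal_mul (by positivity)]
    congr 1
    have e : t ^ (-(a + γ)) * t ^ (γ - (n : ℝ) / 2) = t ^ (-a) * t ^ (-(n : ℝ) / 2) := by
      rw [← Real.rpow_add ht, ← Real.rpow_add ht]; ring_nf
    linear_combination (-A * rexp (-t) * rexp (-(c / t) * ‖z‖ ^ 2)) * e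
  by_cases hqt : q = ∞
  · subst hqt
    rw [eLpNorm_exponent_top]
    refine lt_of_le_of_lt (eLpNormEssSup_le_of_ae_enorm_bound
      (C := (∫⁻ t in Set.Ioi (0:ℝ), W t) * ENNReal.ofReal A) (Filter.Eventually.of_forall fun z => ?_))
      (ENNReal.mul_lt_top hW (by simp))
    rw [enorm_eq_self, hGe, ← lintegral_mul_const _ hWm]
    refine setLIntegral_mono (by fun_prop) fun t ht => ?_
    have ht : 0 < t := ht
    simp only [H]
    gcongr
    have e : γ - (n : ℝ) / 2 = 0 := by rw [hγ]; simp
    rw [e]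
    simp only [Real.rpow_zero, mul_one]
    have : rexp (-(c / t) * ‖z‖ ^ 2) ≤ 1 := by
      rw [Real.exp_le_one_iff]
      have : 0 ≤ (c / t) * ‖z‖ ^ 2 := by positivity
      linarith
    nlinarith
  have hq0 : q ≠ 0 := (one_pos.trans_le hq).ne'
  have hQ1 : 1 ≤ q.toReal := by
    have := ENNReal.toReal_mono hqt hq
    simpa using this
  rw [ENNReal.toReal_inv] at hγ
  rw [eLpNorm_eq_lintegral_rpow_enorm_toReal hq0 hqt]
  generalize q.toReal = Q at *
  have hQ : 0 < Q := by linarith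
  have hQi : Q⁻¹ ≤ 1 := inv_le_one_of_one_le₀ hQ1
  simp only [enorm_eq_self]
  apply ENNReal.rpow_lt_top_of_nonneg (by positivity)
  refine ne_of_lt ?_
  set D := ∫⁻ t in Set.Ioi (0:ℝ), W t with hD
  have hpt : ∀ z, hzG n A c a z ≤ (∫⁻ t in Set.Ioi (0:ℝ), W t * H z t ^ Q) ^ Q⁻¹ * D ^ (1 - Q⁻¹) := by
    intro z
    rw [hGe]
    have hHz : Measurable (H z) := hHm.of_uncurry_left
    have := ENNReal.lintegral_prod_norm_pow_le (μ := volume.restrict (Set.Ioi (0:ℝ))) Finset.univ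
      (f := ![fun t => W t * H z t ^ Q, W])
      (p := ![Q⁻¹, 1 - Q⁻¹])
      (by intro i _; fin_cases i <;> simp <;> fun_prop)
      (by simp [Fin.sum_univ_succ])
      (by intro i _; fin_cases i <;> simp <;> first | positivity | linarith)
    simp only [Fin.prod_univ_succ, Finset.univ_eq_empty, Finset.prod_empty, mul_one,
      Matrix.cons_val_zero, Matrix.cons_val_succ] at this
    refine le_trans (le_of_eq ?_) this
    congr 1
    ext t
    rw [ENNReal.mul_rpow_of_nonneg _ _ (by positivity), ← ENNReal.rpow_mul, mul_inv_cancel₀ hQ.ne',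
      ENNReal.rpow_one, mul_right_comm, ← ENNReal.rpow_add_of_nonneg _ _ (by positivity) (by linarith)]
    simp
  have hHI : ∀ t ∈ Set.Ioi (0:ℝ), ∫⁻ z, W t * H z t ^ Q
      = W t * ENNReal.ofReal (A ^ Q * (π / (c * Q)) ^ ((n : ℝ) / 2)) := by
    intro t ht
    have ht : 0 < t := ht
    have e : ∀ z, H z t ^ Q = ENNReal.ofReal (A ^ Q * t ^ (-((n : ℝ) / 2))) *
        ENNReal.ofReal (rexp (-(c * Q / t) * ‖z‖ ^ 2)) := by
      intro z
      simp only [H]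
      rw [ENNReal.ofReal_rpow_of_nonneg (by positivity) hQ.le, ← ENNReal.ofReal_mul (by positivity)]
      congr 1
      rw [Real.mul_rpow (by positivity) (by positivity), Real.mul_rpow (by positivity) (by positivity),
        ← Real.rpow_mul ht.le, ← Real.exp_mul]
      congr 2
      · congr 1
        rw [hγ]; field_simp; ring
      · field_simp
    simp only [e]
    rw [lintegral_const_mul _ (by fun_prop), lintegral_const_mul _ (by fun_prop),
      hz_gauss_lint n (by positivity), ← ENNReal.ofReal_mul (by positivity)]
    congr 2
    have e2 : π / (c * Q / t) = (π / (c * Q)) * t := by field_simp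
    rw [e2, Real.mul_rpow (by positivity) ht.le]
    have e3 : t ^ (-((n : ℝ) / 2)) * t ^ ((n : ℝ) / 2) = 1 := by
      rw [← Real.rpow_add ht]; simp
    linear_combination (A ^ Q * (π / (c * Q)) ^ ((n : ℝ) / 2)) * e3
  have hm2 : Measurable (fun s : hzE n × ℝ => W s.2 * H s.1 s.2 ^ Q) :=
    (hWm.comp measurable_snd).mul (hHm.pow_const Q)
  calc ∫⁻ z, hzG n A c a z ^ Q
      ≤ ∫⁻ z, (∫⁻ t in Set.Ioi (0:ℝ), W t * H z t ^ Q) * (D ^ (1 - Q⁻¹)) ^ Q := by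
        apply lintegral_mono
        intro z
        refine (ENNReal.rpow_le_rpow (hpt z) hQ.le).trans (le_of_eq ?_)
        rw [ENNReal.mul_rpow_of_nonneg _ _ hQ.le, ← ENNReal.rpow_mul, inv_mul_cancel₀ hQ.ne',
            ENNReal.rpow_one]
    _ = D * ENNReal.ofReal (A ^ Q * (π / (c * Q)) ^ ((n : ℝ) / 2)) * (D ^ (1 - Q⁻¹)) ^ Q := by
        rw [lintegral_mul_const _ hm2.lintegral_prod_right']
        congr 1
        rw [lintegral_lintegral_swap hm2.aemeasurable,
          setLIntegral_congr_fun measurableSet_Ioi hHI, lintegral_mul_const _ hWm]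
    _ < ∞ := by
        refine ENNReal.mul_lt_top (ENNReal.mul_lt_top hW (by simp)) ?_
        exact ENNReal.rpow_lt_top_of_nonneg hQ.le
          (ENNReal.rpow_lt_top_of_nonneg (by linarith) hW.ne).ne

lemma hz_deriv_comm {n : ℕ} (u : 𝓢(hzE n, ℝ)) (e m : hzE n) :
    ∂_{e} (∂_{m} u) = ∂_{m} (∂_{e} u) := by
  have key : ∀ (a b : hzE n) (x : hzE n), ∂_{a} (∂_{b} u) x = fderiv ℝ (fderiv ℝ (⇑u)) x a b := by
    intro a b x
    rw [SchwartzMap.lineDerivOp_apply_eq_fderiv]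
    have h1 : ⇑(∂_{b} u : 𝓢(hzE n, ℝ)) = fun y => fderiv ℝ (⇑u) y b := rfl
    have hd : DifferentiableAt ℝ (fderiv ℝ (⇑u)) x :=
      ((u.smooth 2).fderiv_right (m := 1) (by norm_num)).differentiable (by norm_num) x
    rw [h1, fderiv_clm_apply hd (differentiableAt_const b)]
    simp
  ext x
  rw [key, key]
  have := (u.smooth 2).contDiffAt (x := x) |>.isSymmSndFDerivAt (by simp)
  exact this e m

lemma hz_lap_deriv {n : ℕ} (u : 𝓢(hzE n, ℝ)) (e : hzE n) :
    Δ (∂_{e} u) = ∂_{e} (Δ u) := by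
  rw [SchwartzMap.laplacian_eq_sum (EuclideanSpace.basisFun (Fin n) ℝ),
    SchwartzMap.laplacian_eq_sum (EuclideanSpace.basisFun (Fin n) ℝ)]
  have : ∂_{e} (∑ i, ∂_{EuclideanSpace.basisFun (Fin n) ℝ i}
      (∂_{EuclideanSpace.basisFun (Fin n) ℝ i} u)) =
      ∑ i, ∂_{e} (∂_{EuclideanSpace.basisFun (Fin n) ℝ i}
      (∂_{EuclideanSpace.basisFun (Fin n) ℝ i} u)) :=
    map_sum ((SchwartzMap.evalCLM ℝ (hzE n) ℝ e ∘L SchwartzMap.fderivCLM ℝ (hzE n) ℝ)) _ _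
  rw [this]
  congr 1
  ext1 i
  rw [hz_deriv_comm u _ e, hz_deriv_comm (∂_{_} u) e]

lemma hz_v_deriv {n : ℕ} (α : ℝ) (u : 𝓢(hzE n, ℝ)) (e : hzE n) :
    ∂_{e} u - (α ^ 2) • Δ (∂_{e} u) = ∂_{e} (u - (α ^ 2) • Δ u) := by
  rw [hz_lap_deriv]
  have := (SchwartzMap.evalCLM ℝ (hzE n) ℝ e ∘L SchwartzMap.fderivCLM ℝ (hzE n) ℝ).map_sub u
    ((α ^ 2) • Δ u)
  rw [map_smul] at this
  exact this.symm

lemma hz_bound {n : ℕ} {A c a : ℝ} {F : ℝ → ℝ} {f : hzE n → ℝ≥0∞} (hf : Measurable f) (x : hzE n)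
    (h : ∀ t ∈ Set.Ioi (0:ℝ), ‖F t‖ₑ ≤ ∫⁻ y, ENNReal.ofReal (hzk n A c a t (x - y)) * f y) :
    ‖∫ t in Set.Ioi (0:ℝ), F t‖ₑ ≤ ∫⁻ y, hzG n A c a (x - y) * f y := by
  have hm : Measurable (fun s : ℝ × hzE n => ENNReal.ofReal (hzk n A c a s.1 (x - s.2)) * f s.2) := by
    unfold hzk; fun_prop
  calc _ ≤ ∫⁻ t in Set.Ioi (0:ℝ), ‖F t‖ₑ := enorm_integral_le_lintegral_enorm _
    _ ≤ ∫⁻ t in Set.Ioi (0:ℝ), ∫⁻ y, ENNReal.ofReal (hzk n A c a t (x - y)) * f y :=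
        setLIntegral_mono hm.lintegral_prod_right' h
    _ = ∫⁻ y, ∫⁻ t in Set.Ioi (0:ℝ), ENNReal.ofReal (hzk n A c a t (x - y)) * f y :=
        lintegral_lintegral_swap hm.aemeasurable
    _ = _ := by
        congr 1
        ext y
        rw [lintegral_mul_const _ (by unfold hzk; fun_prop)]
        rfl

lemma hz_enorm_int {n : ℕ} {s : ℝ} (hs : 0 < s) {k v : hzE n → ℝ} {b : hzE n → ℝ}
    (hk : ∀ y, s * |k y| ≤ b y) :
    ‖s * ∫ y, k y * v y‖ₑ ≤ ∫⁻ y, ENNReal.ofReal (b y) * ‖v y‖ₑ := by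
  rw [← integral_const_mul]
  refine (enorm_integral_le_lintegral_enorm _).trans (lintegral_mono fun y => ?_)
  rw [← mul_assoc, enorm_mul]
  gcongr
  rw [Real.enorm_eq_ofReal_abs, abs_mul, abs_of_pos hs]
  exact ENNReal.ofReal_le_ofReal (hk y)

lemma hz_pt {n : ℕ} {α : ℝ} (hα : 0 < α) (u : 𝓢(hzE n, ℝ)) (x : hzE n) :
    ‖u x‖ₑ ≤ ∫⁻ y, hzG n ((4 * π * α ^ 2) ^ (-(n : ℝ) / 2)) (1 / (4 * α ^ 2)) 0 (x - y) *
      ‖(u - (α ^ 2) • Δ u) y‖ₑ := by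
  rw [hz_rep hα u x]
  have hv := (u - (α ^ 2) • Δ u).continuous.measurable
  refine hz_bound hv.enorm x fun t ht => ?_
  have ht : 0 < t := ht
  refine hz_enorm_int (Real.exp_pos _) fun y => le_of_eq ?_
  rw [abs_of_nonneg (by unfold hzK; positivity)]
  unfold hzK hzk
  rw [Real.mul_rpow (by positivity) ht.le]
  have : -‖x - y‖ ^ 2 / (4 * α ^ 2 * t) = -(1 / (4 * α ^ 2) / t) * ‖x - y‖ ^ 2 := by
    field_simp
  rw [this]
  simp
  ring

lemma hzK_fderiv {n : ℕ} (α t : ℝ) (x y e : hzE n) :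
    HasFDerivAt (fun y => hzK n α t (x - y))
      (hzK n α t (x - y) • ((2 / (4 * α ^ 2 * t)) • innerSL ℝ (x - y))) y := by
  have h0 : HasFDerivAt (fun y : hzE n => x - y) (-(ContinuousLinearMap.id ℝ (hzE n))) y :=
    (hasFDerivAt_id y).const_sub x
  have h1 := ((h0.norm_sq.neg.mul_const (4 * α ^ 2 * t)⁻¹).exp).const_mul
    ((4 * π * α ^ 2 * t) ^ (-(n : ℝ) / 2))
  unfold hzK
  simp only [div_eq_mul_inv _ (4 * α ^ 2 * t)]
  refine h1.congr_fderiv ?_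
  ext z
  simp
  ring

lemma hz_pt_deriv {n : ℕ} {α : ℝ} (hα : 0 < α) (u : 𝓢(hzE n, ℝ)) (x e : hzE n) :
    ‖fderiv ℝ (⇑u) x e‖ₑ ≤ ‖e‖ₑ * ∫⁻ y, hzG n ((4 * π * α ^ 2) ^ (-(n : ℝ) / 2) * α⁻¹)
      (1 / (8 * α ^ 2)) (1 / 2) (x - y) * ‖(u - (α ^ 2) • Δ u) y‖ₑ := by
  rw [← SchwartzMap.lineDerivOp_apply_eq_fderiv, hz_rep hα (∂_{e} u) x, hz_v_deriv]
  set v := u - (α ^ 2) • Δ u with hvd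
  have hv := v.continuous.measurable
  have hkb : ∀ t : ℝ, 0 < t → ∀ y, |fderiv ℝ (fun y => hzK n α t (x - y)) y e| ≤
      ‖e‖ * ((4 * π * α ^ 2) ^ (-(n : ℝ) / 2) * α⁻¹ * t ^ (-(1 / 2) : ℝ) * (t ^ (-(n : ℝ) / 2) *
        rexp (-(1 / (8 * α ^ 2) / t) * ‖x - y‖ ^ 2))) := by
    intro t ht y
    rw [(hzK_fderiv α t x y e).fderiv]
    simp only [ContinuousLinearMap.smul_apply, innerSL_apply_apply, smul_eq_mul]
    rw [abs_mul, abs_mul]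
    unfold hzK
    set z := x - y
    rw [abs_of_nonneg (by positivity), abs_of_pos (by positivity : 0 < 2 / (4 * α ^ 2 * t)),
      Real.mul_rpow (by positivity) ht.le]
    have hin : |inner ℝ z e| ≤ ‖z‖ * ‖e‖ := abs_real_inner_le_norm z e
    set s := α * √t with hs
    have hs0 : 0 < s := by positivity
    have hs2 : s ^ 2 = α ^ 2 * t := by rw [hs, mul_pow, Real.sq_sqrt ht.le]
    have ht2 : t ^ (-(1 / 2) : ℝ) = (√t)⁻¹ := by
      rw [Real.rpow_neg ht.le, Real.sqrt_eq_rpow]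
    have e1 : -‖z‖ ^ 2 / (4 * α ^ 2 * t) = -(‖z‖ / s) ^ 2 / 8 + -(‖z‖ / s) ^ 2 / 8 := by
      rw [div_pow, hs2]; field_simp; ring
    have e2 : -(1 / (8 * α ^ 2) / t) * ‖z‖ ^ 2 = -(‖z‖ / s) ^ 2 / 8 := by
      rw [div_pow, hs2]; field_simp
    have e3 : 2 / (4 * α ^ 2 * t) = 1 / (2 * s ^ 2) := by rw [hs2]; field_simp; norm_num
    have e4 : ‖z‖ / s * rexp (-(‖z‖ / s) ^ 2 / 8) ≤ 2 := by
      have h1 := Real.add_one_le_exp ((‖z‖ / s) ^ 2 / 8)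
      have h2 : rexp (-(‖z‖ / s) ^ 2 / 8) * rexp ((‖z‖ / s) ^ 2 / 8) = 1 := by
        rw [← Real.exp_add]; ring_nf; simp
      have h3 : ‖z‖ / s ≤ 2 * rexp ((‖z‖ / s) ^ 2 / 8) := by nlinarith [sq_nonneg (‖z‖ / s - 2)]
      have h4 := Real.exp_pos (-(‖z‖ / s) ^ 2 / 8)
      nlinarith
    rw [e1, e2, e3, Real.exp_add, ht2]
    have e5 : α⁻¹ * (√t)⁻¹ = s⁻¹ := by rw [hs, mul_inv]
    set B := (4 * π * α ^ 2) ^ (-(n : ℝ) / 2)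
    set T := t ^ (-(n : ℝ) / 2)
    have hB : 0 < B := by positivity
    have hT : 0 < T := by positivity
    set X := rexp (-(‖z‖ / s) ^ 2 / 8)
    have hX : 0 < X := Real.exp_pos _
    calc B * T * (X * X) * (1 / (2 * s ^ 2) * |inner ℝ z e|)
        ≤ B * T * (X * X) * (1 / (2 * s ^ 2) * (‖z‖ * ‖e‖)) := by gcongr
      _ = (B * T * X * ‖e‖ * s⁻¹ / 2) * (‖z‖ / s * X) := by field_simp
      _ ≤ (B * T * X * ‖e‖ * s⁻¹ / 2) * 2 := by gcongr
      _ = ‖e‖ * (B * (α⁻¹ * (√t)⁻¹) * (T * X)) := by rw [e5]; ring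
      _ = _ := by ring
  have hparts : ∀ t : ℝ, 0 < t → ∫ y, hzK n α t (x - y) * (∂_{e} v) y
      = - ∫ y, fderiv ℝ (fun y => hzK n α t (x - y)) y e * v y := by
    intro t ht
    have hKc : Continuous (fun y => hzK n α t (x - y)) := by unfold hzK; fun_prop
    have hKb : ∀ y, ‖hzK n α t (x - y)‖ ≤ (4 * π * α ^ 2 * t) ^ (-(n : ℝ) / 2) := by
      intro y
      unfold hzK
      rw [Real.norm_eq_abs, abs_of_nonneg (by positivity)]
      refine mul_le_of_le_one_right (by positivity) ?_
      rw [Real.exp_le_one_iff, neg_div]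
      have : 0 ≤ ‖x - y‖ ^ 2 / (4 * α ^ 2 * t) := by positivity
      linarith
    refine integral_mul_fderiv_eq_neg_fderiv_mul_of_integrable (g := ⇑v) ?_ ?_ ?_ ?_ ?_
    · refine v.integrable.bdd_mul (c := ‖e‖ * ((4 * π * α ^ 2) ^ (-(n : ℝ) / 2) * α⁻¹ *
        t ^ (-(1 / 2) : ℝ) * t ^ (-(n : ℝ) / 2))) ?_ (Filter.Eventually.of_forall fun y => ?_)
      · exact (measurable_fderiv_apply_const ℝ _ e).aestronglyMeasurable
      · refine (hkb t ht y).trans ?_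
        gcongr
        refine mul_le_of_le_one_right (by positivity) ?_
        rw [Real.exp_le_one_iff]
        have : 0 ≤ (1 / (8 * α ^ 2) / t) * ‖x - y‖ ^ 2 := by positivity
        linarith
    · exact (∂_{e} v).integrable.bdd_mul hKc.aestronglyMeasurable (Filter.Eventually.of_forall hKb)
    · exact v.integrable.bdd_mul hKc.aestronglyMeasurable (Filter.Eventually.of_forall hKb)
    · exact fun y _ => (hzK_fderiv α t x y e).differentiableAt
    · exact fun y _ => v.differentiableAt
  have hb := hz_bound (n := n) (A := (4 * π * α ^ 2) ^ (-(n : ℝ) / 2) * α⁻¹)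
      (c := 1 / (8 * α ^ 2)) (a := 1 / 2) (f := fun y => ‖e‖ₑ * ‖v y‖ₑ)
      (F := fun t => rexp (-t) * ∫ y, hzK n α t (x - y) * (∂_{e} v) y)
      (hv.enorm.const_mul _) x (fun t ht => by
    have ht : 0 < t := ht
    rw [hparts t ht, mul_neg, enorm_neg]
    refine (hz_enorm_int (b := fun y => hzk n ((4 * π * α ^ 2) ^ (-(n : ℝ) / 2) * α⁻¹)
      (1 / (8 * α ^ 2)) (1 / 2) t (x - y) * ‖e‖) (Real.exp_pos _) fun y => ?_).trans (le_of_eq ?_)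
    · refine (mul_le_mul_of_nonneg_left (hkb t ht y) (Real.exp_pos _).le).trans (le_of_eq ?_)
      unfold hzk
      ring
    · congr 1
      ext y
      rw [ENNReal.ofReal_mul (by unfold hzk; positivity), ofReal_norm_eq_enorm, mul_assoc])
  refine hb.trans (le_of_eq ?_)
  have hGm := hzG_meas n ((4 * π * α ^ 2) ^ (-(n : ℝ) / 2) * α⁻¹) (1 / (8 * α ^ 2)) (1 / 2)
  rw [← lintegral_const_mul _ (by fun_prop)]
  congr 1
  ext y
  ring

lemma hz_pt_fderiv {n : ℕ} {α : ℝ} (hα : 0 < α) (u : 𝓢(hzE n, ℝ)) (x : hzE n) :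
    ‖fderiv ℝ (⇑u) x‖ₑ ≤ ∫⁻ y, hzG n ((4 * π * α ^ 2) ^ (-(n : ℝ) / 2) * α⁻¹)
      (1 / (8 * α ^ 2)) (1 / 2) (x - y) * ‖(u - (α ^ 2) • Δ u) y‖ₑ := by
  have h := hz_pt_deriv hα u x
  generalize (∫⁻ y, hzG n ((4 * π * α ^ 2) ^ (-(n : ℝ) / 2) * α⁻¹)
      (1 / (8 * α ^ 2)) (1 / 2) (x - y) * ‖(u - (α ^ 2) • Δ u) y‖ₑ) = M at h ⊢
  by_cases hM : M = ∞
  · simp [hM]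
  rw [← ENNReal.ofReal_toReal hM, ← ofReal_norm_eq_enorm]
  refine ENNReal.ofReal_le_ofReal (ContinuousLinearMap.opNorm_le_bound _ ENNReal.toReal_nonneg fun e => ?_)
  have := ENNReal.toReal_mono (ENNReal.mul_ne_top (by simp) hM) (h e)
  rw [ENNReal.toReal_mul] at this
  simpa [mul_comm] using this

lemma hz_exp {r p : ℝ≥0∞} (hr : 1 ≤ r) (hrp : r ≤ p) : ∃ q : ℝ≥0∞, 1 ≤ q ∧ q⁻¹ + r⁻¹ = 1 + p⁻¹ ∧
    1 - (q⁻¹).toReal = (1 / r).toReal - (1 / p).toReal := by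
  have hri : r⁻¹ ≤ 1 := ENNReal.inv_le_one.mpr hr
  have hpi : p⁻¹ ≤ r⁻¹ := ENNReal.inv_le_inv.mpr hrp
  have hrt : r⁻¹ ≠ ∞ := ne_top_of_le_ne_top (by simp) hri
  have hpt : p⁻¹ ≠ ∞ := ne_top_of_le_ne_top hrt hpi
  have hle : r⁻¹ ≤ 1 + p⁻¹ := hri.trans le_self_add
  refine ⟨(1 + p⁻¹ - r⁻¹)⁻¹, ?_, ?_, ?_⟩
  · rw [ENNReal.one_le_inv]
    exact tsub_le_iff_right.mpr (by gcongr)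
  · rw [inv_inv, tsub_add_cancel_of_le hle]
  · rw [inv_inv, ENNReal.toReal_sub_of_le hle (by simp [hpt]), ENNReal.toReal_add (by simp) hpt]
    simp
    ring

/-- Lemma 3.3: bounds for the Helmholtz filter `v = u - α²Δu` on Schwartz functions. -/
theorem helmholtz_bounds (n : ℕ) (hn : 1 ≤ n) (α : ℝ) (hα : 0 < α) :
    -- (i) `‖u‖_p ≤ ‖v‖_p` for every `p ∈ [1,∞]`
    (∀ p : ℝ≥0∞, 1 ≤ p → ∀ u : SchwartzMap (EuclideanSpace ℝ (Fin n)) ℝ,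
      eLpNorm (⇑u) p volume
        ≤ eLpNorm (fun x => u x - α ^ 2 * lapN (⇑u) x) p volume) ∧
    -- (ii) `‖u‖_p ≤ C ‖v‖_r` when `γ = (n/2)(1/r - 1/p) < 1`
    (∀ r p : ℝ≥0∞, 1 ≤ r → r ≤ p →
      (n : ℝ) / 2 * ((1 / r).toReal - (1 / p).toReal) < 1 →
      ∃ C : ℝ, 0 < C ∧ ∀ u : SchwartzMap (EuclideanSpace ℝ (Fin n)) ℝ,
        eLpNorm (⇑u) p volume
          ≤ ENNReal.ofReal C * eLpNorm (fun x => u x - α ^ 2 * lapN (⇑u) x) r volume) ∧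
    -- (iii) `‖∇u‖_p ≤ C' ‖v‖_r` when `γ = (n/2)(1/r - 1/p) < 1/2`
    (∀ r p : ℝ≥0∞, 1 ≤ r → r ≤ p →
      (n : ℝ) / 2 * ((1 / r).toReal - (1 / p).toReal) < 1 / 2 →
      ∃ C' : ℝ, 0 < C' ∧ ∀ u : SchwartzMap (EuclideanSpace ℝ (Fin n)) ℝ,
        eLpNorm (fun x => ‖fderiv ℝ (⇑u) x‖) p volume
          ≤ ENNReal.ofReal C' * eLpNorm (fun x => u x - α ^ 2 * lapN (⇑u) x) r volume) := by
  have hve : ∀ u : SchwartzMap (EuclideanSpace ℝ (Fin n)) ℝ,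
      (fun x => u x - α ^ 2 * lapN (⇑u) x) = ⇑(u - (α ^ 2) • Δ u) := by
    intro u
    ext x
    rw [hz_lap]
    rfl
  have hB : 0 < (4 * π * α ^ 2) ^ (-(n : ℝ) / 2) := by positivity
  have gen : ∀ (A c a : ℝ), ∀ r p q : ℝ≥0∞, 1 ≤ r → r ≤ p → q⁻¹ + r⁻¹ = 1 + p⁻¹ →
      ∀ u : SchwartzMap (EuclideanSpace ℝ (Fin n)) ℝ, ∀ w : EuclideanSpace ℝ (Fin n) → ℝ,
      (∀ x, ‖w x‖ₑ ≤ ∫⁻ y, hzG n A c a (x - y) * ‖(u - (α ^ 2) • Δ u) y‖ₑ) →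
      eLpNorm w p volume ≤ eLpNorm (hzG n A c a) q volume *
        eLpNorm (fun x => u x - α ^ 2 * lapN (⇑u) x) r volume := by
    intro A c a r p q hr hrp hq u w hw
    have hv := (u - (α ^ 2) • Δ u).continuous.measurable
    have h1 := hz_young hr hrp hq (hzG_meas n A c a) hv.enorm
    rw [hve]
    rw [eLpNorm_enorm] at h1
    refine le_trans ?_ h1
    refine eLpNorm_mono_enorm fun x => ?_
    simpa using hw x
  refine ⟨?_, ?_, ?_⟩
  · intro p hp u
    have h := gen ((4 * π * α ^ 2) ^ (-(n : ℝ) / 2)) (1 / (4 * α ^ 2)) 0 p p 1 hp le_rfl (by simp)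
      u u (hz_pt hα u)
    rw [hzG_one hB (by positivity), one_mul] at h
    · exact h
    · have : π / (1 / (4 * α ^ 2)) = 4 * π * α ^ 2 := by field_simp
      rw [this, ← Real.rpow_add (by positivity), neg_div, neg_add_cancel, Real.rpow_zero]
  · intro r p hr hrp hγ
    obtain ⟨q, hq1, hq2, hq3⟩ := hz_exp hr hrp
    have hfin := hzG_fin (n := n) (a := 0) (q := q) hB (show 0 < 1 / (4 * α ^ 2) by positivity) hq1
      (by rw [hq3]; linarith)
    refine ⟨(eLpNorm (hzG n ((4 * π * α ^ 2) ^ (-(n : ℝ) / 2)) (1 / (4 * α ^ 2)) 0) q volume).toReal + 1,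
      by positivity, fun u => ?_⟩
    refine (gen _ _ _ r p q hr hrp hq2 u u (hz_pt hα u)).trans ?_
    gcongr
    refine (ENNReal.ofReal_toReal hfin.ne).symm.le.trans (ENNReal.ofReal_le_ofReal (by linarith))
  · intro r p hr hrp hγ
    obtain ⟨q, hq1, hq2, hq3⟩ := hz_exp hr hrp
    have hfin := hzG_fin (n := n) (a := 1 / 2) (q := q)
      (show 0 < (4 * π * α ^ 2) ^ (-(n : ℝ) / 2) * α⁻¹ by positivity)
      (show 0 < 1 / (8 * α ^ 2) by positivity) hq1
      (by rw [hq3]; linarith)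
    refine ⟨(eLpNorm (hzG n ((4 * π * α ^ 2) ^ (-(n : ℝ) / 2) * α⁻¹) (1 / (8 * α ^ 2)) (1 / 2))
      q volume).toReal + 1, by positivity, fun u => ?_⟩
    refine (gen _ _ _ r p q hr hrp hq2 u _ (fun x => by
      rw [enorm_norm]
      exact hz_pt_fderiv hα u x)).trans ?_
    gcongr
    refine (ENNReal.ofReal_toReal hfin.ne).symm.le.trans (ENNReal.ofReal_le_ofReal (by linarith))
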